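/- arXiv:0804.2169 — 4 statements merged into one kernel-verified Lean document; each statement's English description precedes it below -/
import Mathlib

section
/- Let H be an infinite-dimensional complex Hilbert space, B := 𝒦(H) + ℂ·1 ⊆ B(H), and let h ∈ B(H) be self-adjoint. Suppose there exist a real number γ ≥ 0 and an element β ∈ B such that γ·1 + β + β* = 0 and i(hb - bh) = γ·b + bβ + β*b for all b ∈ B. Then h ∈ B. (Equivalently: for self-adjoint h ∈ B(H) \ B, the generator L(b) = i(hb - bh) of the Markov automorphism semigroup ϑ_t = e^{ith} • e^{-ith} admits no Christensen–Evans form with central ζ, so ϑ is nonspatial.) -/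
/-- `B = 𝒦(H) + ℂ·1`, the unital C*-subalgebra of `B(H)` obtained by adjoining
the identity to the compact operators. -/
def compactsPlusOne (H : Type*) [NormedAddCommGroup H] [InnerProductSpace ℂ H] :
    Set (H →L[ℂ] H) :=
  {x | ∃ k : H →L[ℂ] H, IsCompactOperator (⇑k) ∧ ∃ lam : ℂ, x = k + lam • 1}

/-- Rank-one operators are compact. -/
theorem isCompactOperator_smulRight {𝕜 E F : Type*} [NontriviallyNormedField 𝕜]
    [LocallyCompactSpace 𝕜] [NormedAddCommGroup E] [NormedSpace 𝕜 E]
    [NormedAddCommGroup F] [NormedSpace 𝕜 F] (f : E →L[𝕜] 𝕜) (y : F) :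
    IsCompactOperator (f.smulRight y) :=
  (isCompactOperator_of_locallyCompactSpace_dom f).clm_comp
    ((ContinuousLinearMap.id 𝕜 𝕜).smulRight y)

/-- An operator commuting with all rank-one operators is a scalar. -/
theorem exists_eq_smul_one_of_commute_smulRight {𝕜 E : Type*} [NontriviallyNormedField 𝕜]
    [NormedAddCommGroup E] [NormedSpace 𝕜 E] [SeparatingDual 𝕜 E] {T : E →L[𝕜] E}
    (hT : ∀ (f : E →L[𝕜] 𝕜) (y : E), Commute T (f.smulRight y)) :
    ∃ c : 𝕜, T = c • 1 := by
  cases subsingleton_or_nontrivial E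
  · exact ⟨0, Subsingleton.elim _ _⟩
  · obtain ⟨x, hx⟩ := exists_ne (0 : E)
    obtain ⟨f, hf⟩ := SeparatingDual.exists_eq_one (R := 𝕜) hx
    refine ⟨f (T x), ContinuousLinearMap.ext fun y => ?_⟩
    simpa [hf] using DFunLike.congr_fun (hT f y).eq x

/-- if there are `γ ≥ 0` and `β ∈ B` with `γ·1 + β + β* = 0` and
`i(hb - bh) = γ·b + bβ + β*b` for all `b ∈ B`, then `h ∈ B`. -/
theorem stmt2 {H : Type*} [NormedAddCommGroup H] [InnerProductSpace ℂ H] [CompleteSpace H]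
    (hinf : ¬ FiniteDimensional ℂ H)
    (h : H →L[ℂ] H) (hsa : IsSelfAdjoint h)
    (γ : ℝ) (hγ : 0 ≤ γ) (β : H →L[ℂ] H) (hβ : β ∈ compactsPlusOne H)
    (hMarkov : (γ : ℂ) • (1 : H →L[ℂ] H) + β + star β = 0)
    (hCE : ∀ b ∈ compactsPlusOne H,
      Complex.I • (h * b - b * h) = (γ : ℂ) • b + b * β + star β * b) :
    h ∈ compactsPlusOne H := by
  have hstar : star β = -((γ : ℂ) • (1 : H →L[ℂ] H) + β) :=
    (neg_eq_of_add_eq_zero_right hMarkov).symm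
  have hcomm (f : H →L[ℂ] ℂ) (y : H) : Commute (Complex.I • h + β) (f.smulRight y) := by
    have hb := hCE (f.smulRight y) ⟨_, isCompactOperator_smulRight f y, 0, by simp⟩
    rw [hstar, neg_mul, add_mul, smul_mul_assoc, one_mul, smul_sub] at hb
    rw [Commute, SemiconjBy, add_mul, mul_add, smul_mul_assoc, mul_smul_comm, ← sub_eq_zero]
    rw [← sub_eq_zero] at hb
    rw [← hb]
    abel
  obtain ⟨c, hc⟩ := exists_eq_smul_one_of_commute_smulRight hcomm
  obtain ⟨k, hk, lam, rfl⟩ := hβ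
  refine ⟨Complex.I • k, hk.smul Complex.I, Complex.I * (lam - c), ?_⟩
  have hh : h = Complex.I • ((k + lam • 1) - c • 1) := by
    rw [← hc, sub_add_cancel_right, smul_neg, smul_smul, Complex.I_mul_I, neg_one_smul, neg_neg]
  rw [hh, add_sub_assoc, smul_add, ← sub_smul, smul_smul]
end

section
/- Let B be a unital C*-algebra and let c = (c_t)_{t ≥ 0} be a one-parameter semigroup in B, i.e. c_0 = 1 and c_{s+t} = c_s c_t for all s, t ≥ 0. If for every continuous linear functional φ on B the map t ↦ φ(c_t) is continuous on [0,∞) (i.e. t ↦ c_t is continuous for the weak topology of the Banach space B), then t ↦ c_t is continuous for the norm topology of B. -/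
open Filter Topology
open scoped NNReal

section WeaklyContinuous

variable {T E : Type*} [TopologicalSpace T] [NormedAddCommGroup E] [NormedSpace ℂ E] {f : T → E}

theorem isClosed_preimage_of_weakly_continuous
    (hf : ∀ φ : E →L[ℂ] ℂ, Continuous fun t => φ (f t)) {s : Set E} (hs : IsClosed s)
    (hconv : Convex ℝ s) : IsClosed (f ⁻¹' s) := by
  have hcont : Continuous fun t => toWeakSpace ℂ E (f t) :=
    WeakBilin.continuous_of_continuous_eval _ hf
  have hweak : IsClosed (toWeakSpace ℂ E '' s) := by
    rw [← closure_eq_iff_isClosed, ← hconv.toWeakSpace_closure ℂ, hs.closure_eq]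
  have heq : f ⁻¹' s = (fun t => toWeakSpace ℂ E (f t)) ⁻¹' (toWeakSpace ℂ E '' s) := by
    ext t
    exact ((toWeakSpace ℂ E).injective.mem_set_image).symm
  exact heq ▸ hweak.preimage hcont

theorem isSeparable_range_of_weakly_continuous [TopologicalSpace.SeparableSpace T]
    (hf : ∀ φ : E →L[ℂ] ℂ, Continuous fun t => φ (f t)) :
    TopologicalSpace.IsSeparable (Set.range f) := by
  obtain ⟨D, hDc, hD⟩ := TopologicalSpace.exists_countable_dense T
  let V := (Submodule.span ℝ (f '' D)).topologicalClosure
  have hV : IsClosed (f ⁻¹' (V : Set E)) :=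
    isClosed_preimage_of_weakly_continuous hf (Submodule.isClosed_topologicalClosure _) V.convex
  have hDV : D ⊆ f ⁻¹' (V : Set E) := fun t ht =>
    Submodule.le_topologicalClosure _ (Submodule.subset_span (Set.mem_image_of_mem f ht))
  refine ((hDc.image f).isSeparable.span (R := ℝ)).closure.mono ?_
  rintro _ ⟨t, rfl⟩
  exact hV.closure_subset_iff.2 hDV (hD t)

/-- A weakly continuous function on a separable Baire space is norm continuous at the points of a
dense set. -/
theorem dense_setOf_continuousAt_of_weakly_continuous [TopologicalSpace.SeparableSpace T]
    [BaireSpace T] (hf : ∀ φ : E →L[ℂ] ℂ, Continuous fun t => φ (f t)) :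
    Dense {t | ContinuousAt f t} := by
  obtain ⟨S, hSc, hS⟩ := isSeparable_range_of_weakly_continuous hf
  have := hSc.to_subtype
  let F (n : ℕ) (x : S) : Set T := f ⁻¹' Metric.closedBall (x : E) (1 / (n + 1 : ℝ))
  have hdense (n : ℕ) : Dense (⋃ x, interior (F n x)) := by
    refine dense_iUnion_interior_of_closed (fun x =>
      isClosed_preimage_of_weakly_continuous hf Metric.isClosed_closedBall
        (convex_closedBall _ _)) (Set.eq_univ_of_forall fun t => ?_)
    obtain ⟨x, hx, hxt⟩ := Metric.mem_closure_iff.1 (hS (Set.mem_range_self t)) _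
      (Nat.one_div_pos_of_nat (α := ℝ) (n := n))
    exact Set.mem_iUnion.2 ⟨⟨x, hx⟩, hxt.le⟩
  refine (dense_iInter_of_isOpen_nat (fun n => isOpen_iUnion fun x => isOpen_interior)
    hdense).mono fun t ht => Metric.tendsto_nhds.2 fun ε hε => ?_
  obtain ⟨n, hn⟩ := exists_nat_one_div_lt (half_pos hε)
  obtain ⟨x, hx⟩ := Set.mem_iUnion.1 (Set.mem_iInter.1 ht n)
  filter_upwards [mem_interior_iff_mem_nhds.1 hx] with s hs
  have hs' : dist (f s) x ≤ 1 / (n + 1 : ℝ) := hs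
  have ht' : dist (f t) x ≤ 1 / (n + 1 : ℝ) :=
    (interior_subset hx : t ∈ F n x)
  linarith [dist_triangle_right (f s) (f t) x]

theorem exists_norm_le_of_weakly_continuous
    (hf : ∀ φ : E →L[ℂ] ℂ, Continuous fun t => φ (f t)) {K : Set T} (hK : IsCompact K) :
    ∃ M, ∀ t ∈ K, ‖f t‖ ≤ M := by
  obtain ⟨M, hM⟩ := banach_steinhaus
    (g := fun t : K => NormedSpace.inclusionInDoubleDualLi (E := E) ℂ (f t)) fun φ => by
      obtain ⟨C, hC⟩ := hK.exists_bound_of_continuousOn (hf φ).continuousOn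
      exact ⟨C, fun t => hC t t.2⟩
  exact ⟨M, fun t ht => (LinearIsometry.norm_map _ _).ge.trans (hM ⟨t, ht⟩)⟩

end WeaklyContinuous

section Semigroup

variable {A : Type*} [NormedRing A] {c : ℝ≥0 → A}

theorem isClosed_setOf_tendsto_mul {M : ℝ} (hM : ∀ᶠ t in 𝓝 0, ‖c t‖ ≤ M) :
    IsClosed {x : A | Tendsto (fun t => x * c t) (𝓝 0) (𝓝 x)} := by
  have hM0 : 0 ≤ M := (norm_nonneg _).trans hM.self_of_nhds
  refine isClosed_of_closure_subset fun x hx => Metric.tendsto_nhds.2 fun ε hε => ?_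
  obtain ⟨y, hy, hxy⟩ := Metric.mem_closure_iff.1 hx (ε / (2 * (M + 1))) (by positivity)
  rw [dist_eq_norm, lt_div_iff₀ (by positivity)] at hxy
  filter_upwards [hM, Metric.tendsto_nhds.1 hy (ε / 2) (half_pos hε)] with t ht hyt
  rw [dist_eq_norm] at hyt ⊢
  calc ‖x * c t - x‖ = ‖(x - y) * c t + (y * c t - y) - (x - y)‖ := by congr 1; noncomm_ring
    _ ≤ ‖x - y‖ * ‖c t‖ + ‖y * c t - y‖ + ‖x - y‖ :=
      (norm_sub_le _ _).trans (by grw [norm_add_le, norm_mul_le])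
    _ ≤ ‖x - y‖ * M + ‖y * c t - y‖ + ‖x - y‖ := by gcongr
    _ < ε := by linarith

theorem continuous_of_semigroup_of_tendsto_one (hmul : ∀ s t, c (s + t) = c s * c t)
    (hone : Tendsto c (𝓝 0) (𝓝 1)) (hbdd : ∀ r, ∃ M, ∀ t ≤ r, ‖c t‖ ≤ M) : Continuous c := by
  refine continuous_iff_continuousAt.2 fun t => ?_
  obtain ⟨M, hM⟩ := hbdd (t + 1)
  have hle {u v : ℝ≥0} (huv : u ≤ v) (hu : u ≤ t + 1) :
      ‖c v - c u‖ ≤ M * ‖c (nndist u v) - 1‖ := by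
    have hv : v = u + nndist u v := by
      ext
      rw [NNReal.coe_add, coe_nndist, NNReal.dist_eq, abs_sub_comm,
        abs_of_nonneg (sub_nonneg.2 (NNReal.coe_le_coe.2 huv))]
      ring
    calc ‖c v - c u‖ = ‖c u * (c (nndist u v) - 1)‖ := by
          rw [mul_sub, mul_one, ← hmul, ← hv]
      _ ≤ M * ‖c (nndist u v) - 1‖ := by grw [norm_mul_le, hM u hu]
  have hzero : Tendsto (fun s => M * ‖c (nndist s t) - 1‖) (𝓝 t) (𝓝 0) := by
    have hdist : Tendsto (fun s => nndist s t) (𝓝 t) (𝓝 0) :=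
      Continuous.tendsto' (by fun_prop) _ _ (nndist_self t)
    simpa using (((hone.comp hdist).sub_const 1).norm).const_mul M
  refine tendsto_iff_norm_sub_tendsto_zero.2 (squeeze_zero' (Eventually.of_forall fun _ =>
    norm_nonneg _) ?_ hzero)
  filter_upwards [Iic_mem_nhds (lt_add_one t)] with s hs
  obtain h | h := le_total t s
  · rw [nndist_comm]
    exact hle h le_self_add
  · rw [norm_sub_rev]
    exact hle h hs

/-- A weakly continuous one-parameter semigroup in a unital complex normed algebra is norm
continuous. -/
theorem continuous_of_semigroup_of_weakly_continuous [NormedAlgebra ℂ A] (hzero : c 0 = 1)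
    (hmul : ∀ s t, c (s + t) = c s * c t)
    (hweak : ∀ φ : A →L[ℂ] ℂ, Continuous fun t => φ (c t)) : Continuous c := by
  have hbdd (r : ℝ≥0) : ∃ M, ∀ t ≤ r, ‖c t‖ ≤ M := by
    obtain ⟨M, hM⟩ := exists_norm_le_of_weakly_continuous hweak (isCompact_Icc (a := 0) (b := r))
    exact ⟨M, fun t ht => hM t ⟨zero_le, ht⟩⟩
  refine continuous_of_semigroup_of_tendsto_one hmul ?_ hbdd
  let X : Set A := {x | Tendsto (fun t => x * c t) (𝓝 0) (𝓝 x)}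
  have hXclosed : IsClosed X := by
    obtain ⟨M, hM⟩ := hbdd 1
    exact isClosed_setOf_tendsto_mul
      (Filter.mem_of_superset (Iic_mem_nhds one_pos) fun t ht => hM t ht)
  have hXconv : Convex ℝ X := fun x hx y hy a b _ _ _ => by
    have h := (Tendsto.const_smul hx a).add (Tendsto.const_smul hy b)
    simpa only [X, Set.mem_ofPred_eq, add_mul, smul_mul_assoc] using h
  have hcont : {t | ContinuousAt c t} ⊆ c ⁻¹' X := fun t ht => by
    have hadd : Tendsto (fun s => t + s) (𝓝 0) (𝓝 t) :=
      Continuous.tendsto' (by fun_prop) _ _ (add_zero t)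
    exact (ht.tendsto.comp hadd).congr fun s => hmul t s
  have hmem : (0 : ℝ≥0) ∈ c ⁻¹' X :=
    (isClosed_preimage_of_weakly_continuous hweak hXclosed hXconv).closure_subset_iff.2 hcont
      (dense_setOf_continuousAt_of_weakly_continuous hweak 0)
  simpa [X, hzero] using hmem

end Semigroup

/-- a one-parameter semigroup in a unital C*-algebra that is
continuous for the weak topology of the Banach space `B` is norm continuous. -/
theorem stmt5 {B : Type*} [NormedRing B] [StarRing B] [CStarRing B]
    [NormedAlgebra ℂ B] [CompleteSpace B]
    (c : ℝ → B) (hc0 : c 0 = 1)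
    (hmul : ∀ s t : ℝ, 0 ≤ s → 0 ≤ t → c (s + t) = c s * c t)
    (hweak : ∀ φ : B →L[ℂ] ℂ, ContinuousOn (fun t => φ (c t)) (Set.Ici (0 : ℝ))) :
    ContinuousOn c (Set.Ici (0 : ℝ)) := by
  refine continuousOn_iff_continuous_domRestrict.2 ?_
  exact continuous_of_semigroup_of_weakly_continuous (c := fun t : ℝ≥0 => c t) hc0
    (fun s t => hmul s t s.2 t.2) fun φ => continuousOn_iff_continuous_domRestrict.1 (hweak φ)
end

section
/- Let B be a unital C*-algebra, c ∈ B, and let T : B → B be a linear map such that the map b ↦ T(b) - c*bc is completely positive, in the sense that ∑_{i,j} b_i*(T(a_i*a_j) - c*a_i*a_j c)b_j ≥ 0 for all n and all a_1,…,a_n, b_1,…,b_n ∈ B. Then the kernel K over the two-point set {0,1} defined by K^{0,0}(x) = x, K^{0,1}(x) = xc, K^{1,0}(x) = c*x, K^{1,1}(x) = T(x) is completely positive definite: for every n, every s_1,…,s_n ∈ {0,1}, and all a_1,…,a_n, b_1,…,b_n ∈ B, one has ∑_{i,j} b_i* K^{s_i,s_j}(a_i*a_j) b_j ≥ 0 in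 B. -/
/-- The kernel over `{0,1}` (encoded by `Bool`, with `false = 0`, `true = 1`)
given by `K^{0,0} = id`, `K^{0,1} = •c`, `K^{1,0} = c*•`, `K^{1,1} = T`. -/
def theKernel {B : Type*} [NormedRing B] [StarRing B] (T : B → B) (c : B) :
    Bool → Bool → B → B
  | false, false => fun x => x
  | false, true => fun x => x * c
  | true, false => fun x => star c * x
  | true, true => T

/-- if `T - c* • c` is completely positive, then the kernel
`(id, •c; c*•, T)` over the two-point set is completely positive definite. -/
theorem stmt6 {B : Type*} [NormedRing B] [StarRing B] [CStarRing B]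
    [NormedAlgebra ℂ B] [CompleteSpace B] [PartialOrder B] [StarOrderedRing B]
    (T : B →ₗ[ℂ] B) (c : B)
    (hCP : ∀ n : ℕ, ∀ a b : Fin n → B,
      0 ≤ ∑ i, ∑ j, star (b i) *
        (T (star (a i) * a j) - star c * (star (a i) * a j) * c) * b j) :
    ∀ n : ℕ, ∀ s : Fin n → Bool, ∀ a b : Fin n → B,
      0 ≤ ∑ i, ∑ j, star (b i) *
        theKernel (⇑T) c (s i) (s j) (star (a i) * a j) * b j := by
  intro n s a b
  have hsq : 0 ≤ star (∑ i, a i * (bif s i then c * b i else b i)) *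
      ∑ j, a j * (bif s j then c * b j else b j) := star_mul_self_nonneg _
  refine (add_nonneg (hCP n a fun i => bif s i then b i else 0) hsq).trans_eq ?_
  rw [star_sum, Finset.sum_mul_sum]
  simp only [← Finset.sum_add_distrib]
  refine Finset.sum_congr rfl fun i _ => Finset.sum_congr rfl fun j _ => ?_
  cases s i <;> cases s j <;>
    simp only [theKernel, cond_true, cond_false, star_mul, star_zero] <;> noncomm_ring
end

section
/- In the setting below, if 0 ≤ ε ≤ 1 and |1 − g(s)| ≤ ε for all s ∈ [0,∞), then sup_{s ≥ 0} ∫₀ᵗ |F(r)(s)|² dr ≥ t·(1 − ε)². (In the language of Theorem 3.1: if the vacuum component of X_t is within ε of 1, then the squared norm of its one-particle component is at least t(1−ε)²; hence the product subsystem of 𝕀^⊙(F) generated by the unit ξ^⊙ contains no central unit vectors and is not isomorphic to a time-ordered product system.) -/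
open scoped NNReal

/-- Membership in `𝓑 = C₀[0,∞) + ℂ·1`: a continuous function on `[0,∞)`
possessing a finite limit at infinity. -/
def memCB (b : ℝ≥0 → ℂ) : Prop :=
  Continuous b ∧ ∃ l : ℂ, Filter.Tendsto b Filter.atTop (nhds l)

open Filter Topology MeasureTheory

theorem tendsto_add_one_atTop_nnreal : Tendsto (fun s : ℝ≥0 => s + 1) atTop atTop :=
  tendsto_atTop_mono (fun _ => le_self_add) tendsto_id

theorem memCB.exists_norm_le {b : ℝ≥0 → ℂ} (hb : memCB b) : ∃ C : ℝ, ∀ s, ‖b s‖ ≤ C := by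
  obtain ⟨hc, l, hl⟩ := hb
  obtain ⟨a, ha⟩ := eventually_atTop.1 (hl.norm.eventually_le_const (lt_add_one ‖l‖))
  obtain ⟨C, hC⟩ := (isCompact_Icc (a := 0) (b := a)).exists_bound_of_continuousOn hc.continuousOn
  refine ⟨max C (‖l‖ + 1), fun s => ?_⟩
  rcases le_total s a with h | h
  · exact (hC s ⟨zero_le, h⟩).trans (le_max_left _ _)
  · exact (ha s h).trans (le_max_right _ _)

theorem memCB.mul {a b : ℝ≥0 → ℂ} (ha : memCB a) (hb : memCB b) :
    memCB (fun s => a s * b s) := by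
  obtain ⟨ha, l, hl⟩ := ha
  obtain ⟨hb, l', hl'⟩ := hb
  exact ⟨ha.mul hb, l * l', hl.mul hl'⟩

theorem memCB.prod {ι : Type*} {S : Finset ι} {b : ι → ℝ≥0 → ℂ} (hb : ∀ j ∈ S, memCB (b j)) :
    memCB (fun s => ∏ j ∈ S, b j s) := by
  choose! hc l hl using hb
  exact ⟨continuous_finsetProd S hc, ∏ j ∈ S, l j, tendsto_finsetProd S hl⟩

theorem memCB.comp_add_one {b : ℝ≥0 → ℂ} (hb : memCB b) : memCB (fun s => b (s + 1)) := by
  obtain ⟨hc, l, hl⟩ := hb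
  exact ⟨hc.comp (by fun_prop), l, hl.comp tendsto_add_one_atTop_nnreal⟩

/-- Translating the factors with index above `k` does not change the limit of the product. -/
theorem tendsto_prod_shift_mul_prod {b : ℕ → ℝ≥0 → ℂ} {l : ℕ → ℂ} {n k : ℕ} (hk : k < n)
    (hl : ∀ j ≤ n, Tendsto (b j) atTop (𝓝 (l j))) :
    Tendsto (fun s => (∏ j ∈ Finset.Icc (k + 1) n, b j (s + 1)) *
      ∏ j ∈ Finset.range (k + 1), b j s) atTop (𝓝 (∏ j ∈ Finset.range (n + 1), l j)) := by
  have hIcc : Finset.Icc (k + 1) n = Finset.Ico (k + 1) (n + 1) := by ext; simp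
  rw [← Finset.prod_range_mul_prod_Ico l (show k + 1 ≤ n + 1 by omega), mul_comm, ← hIcc]
  refine Tendsto.mul (tendsto_finsetProd _ fun j hj => ?_) (tendsto_finsetProd _ fun j hj => ?_)
  · exact (hl j (Finset.mem_Icc.1 hj).2).comp tendsto_add_one_atTop_nnreal
  · exact hl j (by have := Finset.mem_range.1 hj; omega)

/-- The index of the subinterval containing `r` is monotone in `r`. -/
theorem monotoneOn_partition_index {τ : ℕ → ℝ} {n : ℕ} (hτ : ∀ k < n, 0 < τ k) {S : Set ℝ}
    {κ : ℝ → ℕ} (hκ : ∀ r ∈ S, κ r < n ∧ (∑ j ∈ Finset.range (κ r), τ j) ≤ r ∧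
      r < ∑ j ∈ Finset.range (κ r + 1), τ j) : MonotoneOn κ S := by
  intro r hr r' hr' hrr'
  by_contra! hlt
  obtain ⟨hn, hle, -⟩ := hκ r hr
  obtain ⟨-, -, hlt'⟩ := hκ r' hr'
  have : ∑ j ∈ Finset.range (κ r' + 1), τ j ≤ ∑ j ∈ Finset.range (κ r), τ j :=
    Finset.sum_le_sum_of_subset_of_nonneg (Finset.range_mono hlt) fun j hj _ =>
      (hτ j ((Finset.mem_range.1 hj).trans hn)).le
  linarith

/-- if the vacuum component `g` of `X_t` satisfies `|1 − g(s)| ≤ ε`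
for all `s`, with `0 ≤ ε ≤ 1`, then the squared norm of the one-particle
component, `sup_{s ≥ 0} ∫₀ᵗ |F(r)(s)|² dr`, is at least `t·(1 − ε)²`. -/
theorem stmt10
    (t : ℝ) (ht : 0 < t) (m : ℕ) (hm : 1 ≤ m)
    -- the number of factors n_i ≥ 1 of the i-th summand
    (n : Fin m → ℕ) (hn : ∀ i, 1 ≤ n i)
    -- the time increments t^{(i)}_1, …, t^{(i)}_{n_i} (indexed from 0), positive, summing to t
    (τ : Fin m → ℕ → ℝ)
    (hτpos : ∀ i, ∀ k < n i, 0 < τ i k)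
    (hτsum : ∀ i, ∑ k ∈ Finset.range (n i), τ i k = t)
    -- the elements b^{(i)}_0, …, b^{(i)}_{n_i} of 𝓑
    (b : Fin m → ℕ → ℝ≥0 → ℂ)
    (hb : ∀ i, ∀ j ≤ n i, memCB (b i j))
    -- κ i r is the unique k < n_i with T^{(i)}_k ≤ r < T^{(i)}_{k+1},
    -- where T^{(i)}_k = τ i 0 + ⋯ + τ i (k-1)
    (κ : Fin m → ℝ → ℕ)
    (hκ : ∀ i, ∀ r ∈ Set.Ico (0 : ℝ) t, κ i r < n i ∧
      (∑ j ∈ Finset.range (κ i r), τ i j) ≤ r ∧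
        r < ∑ j ∈ Finset.range (κ i r + 1), τ i j)
    -- the one-particle component F and the vacuum component g
    (F : ℝ → ℝ≥0 → ℂ)
    (hF : ∀ r ∈ Set.Ico (0 : ℝ) t, ∀ s : ℝ≥0,
      F r s = ∑ i, (∏ j ∈ Finset.Icc (κ i r + 1) (n i), b i j (s + 1)) *
        (∏ j ∈ Finset.range (κ i r + 1), b i j s))
    (g : ℝ≥0 → ℂ)
    (hg : ∀ s, g s = ∑ i, ∏ j ∈ Finset.range (n i + 1), b i j s)
    -- the vacuum component is uniformly ε-close to 1
    (ε : ℝ) (hε0 : 0 ≤ ε) (hε1 : ε ≤ 1)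
    (hclose : ∀ s : ℝ≥0, ‖1 - g s‖ ≤ ε) :
    t * (1 - ε) ^ 2 ≤ ⨆ s : ℝ≥0, ∫ r in (0 : ℝ)..t, ‖F r s‖ ^ 2 := by
  choose! hbc l hl using hb
  set G : Fin m → ℕ → ℝ≥0 → ℂ := fun i k s => (∏ j ∈ Finset.Icc (k + 1) (n i), b i j (s + 1)) *
    ∏ j ∈ Finset.range (k + 1), b i j s
  have hmem : ∀ i, ∀ j ≤ n i, memCB (b i j) := fun i j hj => ⟨hbc i j hj, l i j, hl i j hj⟩
  have hGmem : ∀ i, ∀ k < n i, memCB (G i k) := fun i k hk =>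
    (memCB.prod fun j hj => (hmem i j (Finset.mem_Icc.1 hj).2).comp_add_one).mul
      (memCB.prod fun j hj => hmem i j (by have := Finset.mem_range.1 hj; omega))
  have hGbound : ∀ i, ∃ C : ℝ, ∀ k < n i, ∀ s, ‖G i k s‖ ≤ C := by
    intro i
    choose! C hC using fun k hk => (hGmem i k hk).exists_norm_le
    refine ⟨∑ k ∈ Finset.range (n i), |C k|, fun k hk s => ((hC k hk s).trans (le_abs_self _)).trans
      (Finset.single_le_sum (f := fun k => |C k|) (fun _ _ => abs_nonneg _)
        (Finset.mem_range.2 hk))⟩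
  choose C hC using hGbound
  have hFG : ∀ r ∈ Set.Ico (0 : ℝ) t, ∀ s, F r s = ∑ i, G i (κ i r) s := hF
  have hFbound : ∀ r ∈ Set.Ico (0 : ℝ) t, ∀ s, ‖‖F r s‖ ^ 2‖ ≤ (∑ i, C i) ^ 2 := by
    intro r hr s
    rw [norm_pow, norm_norm, hFG r hr s]
    gcongr
    exact norm_sum_le_of_le _ fun i _ => hC i _ (hκ i r hr).1 s
  set L : ℂ := ∑ i, ∏ j ∈ Finset.range (n i + 1), l i j
  have hFlim : ∀ r ∈ Set.Ico (0 : ℝ) t, Tendsto (F r) atTop (𝓝 L) := by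
    intro r hr
    rw [funext (hFG r hr)]
    exact tendsto_finsetSum _ fun i _ => tendsto_prod_shift_mul_prod (hκ i r hr).1 (hl i)
  have hglim : Tendsto g atTop (𝓝 L) := by
    rw [funext hg]
    exact tendsto_finsetSum _ fun i _ => tendsto_finsetProd _ fun j hj =>
      hl i j (Nat.lt_succ_iff.1 (Finset.mem_range.1 hj))
  have hLε : ‖1 - L‖ ≤ ε := le_of_tendsto' (hglim.const_sub 1).norm hclose
  have hL : 1 - ε ≤ ‖L‖ := by
    have := norm_sub_norm_le (1 : ℂ) (1 - L)
    rw [norm_one, sub_sub_cancel] at this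
    linarith
  have hmeas : ∀ s, AEStronglyMeasurable (fun r => ‖F r s‖ ^ 2)
      (volume.restrict (Set.Ico (0 : ℝ) t)) := by
    intro s
    have hκm : ∀ i, AEMeasurable (κ i) (volume.restrict (Set.Ico (0 : ℝ) t)) := fun i =>
      aemeasurable_restrict_of_monotoneOn measurableSet_Ico
        (monotoneOn_partition_index (hτpos i) (hκ i))
    have hsum : AEMeasurable (fun r => ∑ i, G i (κ i r) s)
        (volume.restrict (Set.Ico (0 : ℝ) t)) :=
      Finset.aemeasurable_fun_sum _ fun i _ =>
        (measurable_from_nat (f := fun k => G i k s)).comp_aemeasurable (hκm i)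
    refine ((hsum.norm.pow_const 2).congr ?_).aestronglyMeasurable
    filter_upwards [ae_restrict_mem measurableSet_Ico] with r hr
    rw [hFG r hr s]
  have hIco : ∀ s, ∫ r in (0 : ℝ)..t, ‖F r s‖ ^ 2 = ∫ r in Set.Ico 0 t, ‖F r s‖ ^ 2 := fun s => by
    rw [intervalIntegral.integral_of_le ht.le, integral_Ico_eq_integral_Ioc]
  simp_rw [hIco]
  have hlim : Tendsto (fun s => ∫ r in Set.Ico 0 t, ‖F r s‖ ^ 2) atTop
      (𝓝 (∫ _ in Set.Ico 0 t, ‖L‖ ^ 2)) := by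
    refine tendsto_integral_filter_of_dominated_convergence (fun _ => (∑ i, C i) ^ 2)
      (Eventually.of_forall hmeas) (Eventually.of_forall fun s => ?_)
      (integrable_const _) ?_
    · filter_upwards [ae_restrict_mem measurableSet_Ico] with r hr using hFbound r hr s
    · filter_upwards [ae_restrict_mem measurableSet_Ico] with r hr using (hFlim r hr).norm.pow 2
  have hbdd : BddAbove (Set.range fun s => ∫ r in Set.Ico 0 t, ‖F r s‖ ^ 2) := by
    refine ⟨(∑ i, C i) ^ 2 * volume.real (Set.Ico 0 t), ?_⟩
    rintro _ ⟨s, rfl⟩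
    exact (le_abs_self _).trans (norm_setIntegral_le_of_norm_le_const measure_Ico_lt_top
      fun r hr => hFbound r hr s)
  calc t * (1 - ε) ^ 2 ≤ t * ‖L‖ ^ 2 := by gcongr
    _ = ∫ _ in Set.Ico 0 t, ‖L‖ ^ 2 := by simp [ht.le]
    _ ≤ _ := le_of_tendsto' hlim fun s => le_ciSup hbdd s
end
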